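/- Let F ∈ C^{1,m}(M_F(K)), K = [a,b]^d, meaning F is differentiable with F'(μ; ·) ∈ C^m(K) and all x-derivatives of F' up to order m jointly continuous in (μ, x). Then for every multi-index l with |l| ≤ m and every C > 0, sup over x ∈ K and μ ∈ N_C of |∂^{|l|}_x P_n'(F)(μ; x) − ∂^{|l|}_x F'(μ; x)| → 0 as n → ∞, where P_n'(F)(μ; x) = Σ_j F'(χ_n(μ); a^n_j) φ^n_j(x). -/

import Mathlib

open MeasureTheory Filter Topology
open scoped NNReal ENNReal

noncomputable section

/-- The Dirac measure at `x`, as a finite measure. -/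
def diracFM {Y : Type*} [MeasurableSpace Y] (x : Y) : FiniteMeasure Y :=
  ⟨Measure.dirac x, inferInstance⟩

/-- The grid point `a^n_{j}` in `[a,b]^d`. -/
def bnode (a b : ℝ) (d n : ℕ) (j : Fin d → Fin (n + 1)) : Fin d → ℝ :=
  fun k => a + ((j k : ℕ) : ℝ) * (b - a) / n

/-- The multivariate Bernstein basis polynomial `φ^n_j`. -/
def bpoly (a b : ℝ) (d n : ℕ) (j : Fin d → Fin (n + 1)) (x : Fin d → ℝ) : ℝ :=
  (b - a)⁻¹ ^ (n * d) *
    ∏ k : Fin d, (n.choose (j k) : ℝ) * (x k - a) ^ (j k : ℕ) * (b - x k) ^ (n - (j k : ℕ))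

/-- The Bernstein discretization `χ_n(μ) = Σ_j ⟨φ^n_j, μ⟩ δ_{a^n_j}` of a finite measure. -/
def chiB (a b : ℝ) (d n : ℕ) (μ : FiniteMeasure (Fin d → ℝ)) : FiniteMeasure (Fin d → ℝ) :=
  ∑ j : Fin d → Fin (n + 1),
    (∫ x, bpoly a b d n j x ∂(μ : Measure (Fin d → ℝ))).toNNReal • diracFM (bnode a b d n j)


/-- Partial derivative `∂f/∂x_i` of a function on `ℝ^d`. -/
def pder (d : ℕ) (i : Fin d) (f : (Fin d → ℝ) → ℝ) : (Fin d → ℝ) → ℝ :=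
  fun x => fderiv ℝ f x (Pi.single i 1)

/-- The multi-index partial derivative `∂^{|l|} f / ∂x^l`. -/
def multiDeriv (d : ℕ) (l : Fin d → ℕ) (f : (Fin d → ℝ) → ℝ) : (Fin d → ℝ) → ℝ :=
  (List.finRange d).foldr (fun i h => (pder d i)^[l i] h) f


/-- One-dimensional Bernstein weight, indexed by integers. -/
def qw (N : ℕ) (j : ℤ) (t : ℝ) : ℝ :=
  if 0 ≤ j then (bernsteinPolynomial ℝ N j.toNat).eval t else 0

lemma qw_natCast (N j : ℕ) (t : ℝ) : qw N (j : ℤ) t = (bernsteinPolynomial ℝ N j).eval t := by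
  simp [qw]

lemma qw_eq_zero {N : ℕ} {j : ℤ} (h : ¬ (0 ≤ j ∧ j ≤ N)) (t : ℝ) : qw N j t = 0 := by
  unfold qw
  split_ifs with h0
  · rw [bernsteinPolynomial.eq_zero_of_lt, Polynomial.eval_zero]
    omega
  · rfl

lemma qw_nonneg (N : ℕ) (j : ℤ) {t : ℝ} (h0 : 0 ≤ t) (h1 : t ≤ 1) : 0 ≤ qw N j t := by
  unfold qw
  split_ifs
  · have : 0 ≤ 1 - t := by linarith
    simp only [bernsteinPolynomial, Polynomial.eval_mul, Polynomial.eval_pow, Polynomial.eval_X,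
      Polynomial.eval_sub, Polynomial.eval_one, Polynomial.eval_natCast]
    positivity
  · exact le_rfl

lemma qw_hasDerivAt (N : ℕ) (j : ℤ) (t : ℝ) :
    HasDerivAt (qw N j) (N * (qw (N - 1) (j - 1) t - qw (N - 1) j t)) t := by
  rcases lt_trichotomy j 0 with h | h | h
  · have e : qw N j = fun _ => 0 := by
      funext s; exact qw_eq_zero (by omega) s
    rw [e, qw_eq_zero (by omega), qw_eq_zero (by omega)]
    simpa using hasDerivAt_const t (0 : ℝ)
  · subst h
    have e : qw N 0 = fun s => (bernsteinPolynomial ℝ N 0).eval s := by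
      funext s; exact qw_natCast N 0 s
    rw [qw_eq_zero (j := 0 - 1) (by omega), show (0 : ℤ) = ((0 : ℕ) : ℤ) from rfl, qw_natCast]
    have := (bernsteinPolynomial ℝ N 0).hasDerivAt t
    rw [bernsteinPolynomial.derivative_zero] at this
    simp only [Nat.cast_zero]
    rw [e]
    exact this.congr_deriv (by simp)
  · obtain ⟨k, rfl⟩ : ∃ k : ℕ, j = ((k + 1 : ℕ) : ℤ) := ⟨(j - 1).toNat, by omega⟩
    have e : qw N ((k + 1 : ℕ) : ℤ) = fun s => (bernsteinPolynomial ℝ N (k + 1)).eval s := by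
      funext s; exact qw_natCast N (k + 1) s
    have e2 : (((k + 1 : ℕ) : ℤ) - 1) = (k : ℤ) := by push_cast; ring
    rw [e, e2, qw_natCast, qw_natCast]
    have := (bernsteinPolynomial ℝ N (k + 1)).hasDerivAt t
    rw [bernsteinPolynomial.derivative_succ] at this
    exact this.congr_deriv (by simp)

lemma qw_sum_le (N n : ℕ) (hN : N ≤ n) (g : ℤ → ℝ) (t : ℝ) :
    ∑ j : Fin (n + 1), g ((j : ℕ) : ℤ) * qw N ((j : ℕ) : ℤ) t =
      ∑ j ∈ Finset.range (N + 1), g (j : ℤ) * (bernsteinPolynomial ℝ N j).eval t := by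
  rw [Fin.sum_univ_eq_sum_range (fun j : ℕ => g (j : ℤ) * qw N (j : ℤ) t) (n + 1)]
  symm
  have : ∑ j ∈ Finset.range (N + 1), g (j : ℤ) * (bernsteinPolynomial ℝ N j).eval t
      = ∑ j ∈ Finset.range (N + 1), g (j : ℤ) * qw N (j : ℤ) t := by
    simp only [qw_natCast]
  rw [this]
  apply Finset.sum_subset
  · intro j hj
    simp only [Finset.mem_range] at *
    omega
  · intro j _ hj
    simp only [Finset.mem_range] at hj
    rw [qw_eq_zero (by omega), mul_zero]

lemma qw_sum (N n : ℕ) (hN : N ≤ n) (t : ℝ) :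
    ∑ j : Fin (n + 1), qw N ((j : ℕ) : ℤ) t = 1 := by
  have := qw_sum_le N n hN (fun _ => 1) t
  simp only [one_mul] at this
  rw [this, ← Polynomial.eval_finsetSum, bernsteinPolynomial.sum, Polynomial.eval_one]

lemma qw_var (N n : ℕ) (hN : N ≤ n) (t : ℝ) :
    ∑ j : Fin (n + 1), ((N : ℝ) * t - ((j : ℕ) : ℝ)) ^ 2 * qw N ((j : ℕ) : ℤ) t
      = N * t * (1 - t) := by
  have := qw_sum_le N n hN (fun z => ((N : ℝ) * t - (z : ℝ)) ^ 2) t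
  simp only [Int.cast_natCast] at this
  rw [this]
  have h2 := congrArg (Polynomial.eval t) (bernsteinPolynomial.variance ℝ N)
  rw [Polynomial.eval_finsetSum] at h2
  simpa using h2

/-- variance bound around `n t`. -/
lemma qw_var_le (N n c : ℕ) (hN : N + c = n) {t : ℝ} (h0 : 0 ≤ t) (h1 : t ≤ 1) :
    ∑ j : Fin (n + 1), ((n : ℝ) * t - ((j : ℕ) : ℝ)) ^ 2 * qw N ((j : ℕ) : ℤ) t
      ≤ n + 2 * c ^ 2 := by
  have hn : (n : ℝ) = N + c := by rw [← hN]; push_cast; ring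
  have step : ∀ j : Fin (n + 1), ((n : ℝ) * t - ((j : ℕ) : ℝ)) ^ 2 * qw N ((j : ℕ) : ℤ) t ≤
      2 * (((N : ℝ) * t - ((j : ℕ) : ℝ)) ^ 2 * qw N ((j : ℕ) : ℤ) t)
        + 2 * c ^ 2 * qw N ((j : ℕ) : ℤ) t := by
    intro j
    have hq := qw_nonneg N ((j : ℕ) : ℤ) h0 h1
    have hct : ((c : ℝ) * t) ^ 2 ≤ c ^ 2 := by
      rw [mul_pow]
      have : t ^ 2 ≤ 1 := by nlinarith
      nlinarith [sq_nonneg (c : ℝ)]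
    have : ((n : ℝ) * t - ((j : ℕ) : ℝ)) ^ 2 ≤
      2 * ((N : ℝ) * t - ((j : ℕ) : ℝ)) ^ 2 + 2 * c ^ 2 := by
      rw [hn]
      nlinarith [sq_nonneg (((N : ℝ) * t - ((j : ℕ) : ℝ)) - c * t)]
    nlinarith [mul_le_mul_of_nonneg_right this hq]
  refine (Finset.sum_le_sum fun j _ => step j).trans ?_
  rw [Finset.sum_add_distrib, ← Finset.mul_sum, ← Finset.mul_sum, qw_var N n (by omega),
    qw_sum N n (by omega)]
  have : t * (1 - t) ≤ 1 / 2 := by nlinarith [sq_nonneg (t - 1/2)]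
  have hN0 : (0 : ℝ) ≤ N := Nat.cast_nonneg N
  have hc0 : (0 : ℝ) ≤ c := Nat.cast_nonneg c
  have := mul_le_mul_of_nonneg_left this hN0
  nlinarith

/-- multivariate weights -/
def mw (a b : ℝ) {d : ℕ} (N : Fin d → ℕ) (j : Fin d → ℤ) (x : Fin d → ℝ) : ℝ :=
  ∏ k, qw (N k) (j k) ((x k - a) / (b - a))

/-- lattice coercion -/
def zc {d n : ℕ} (j : Fin d → Fin (n + 1)) : Fin d → ℤ := fun k => ((j k : ℕ) : ℤ)

lemma zc_injective (d n : ℕ) : Function.Injective (zc (d := d) (n := n)) := by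
  intro i j h
  funext k
  have := congrFun h k
  simp only [zc] at this
  exact Fin.ext (by exact_mod_cast this)

lemma mw_eq_zero (a b : ℝ) {d : ℕ} {N : Fin d → ℕ} {j : Fin d → ℤ} {k : Fin d}
    (h : ¬ (0 ≤ j k ∧ j k ≤ N k)) (x : Fin d → ℝ) : mw a b N j x = 0 :=
  Finset.prod_eq_zero (Finset.mem_univ k) (qw_eq_zero h _)

lemma unit_mem {a b : ℝ} (hab : a < b) {d : ℕ} {x : Fin d → ℝ}
    (hx : x ∈ Set.Icc (fun _ : Fin d => a) (fun _ => b)) (k : Fin d) :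
    0 ≤ (x k - a) / (b - a) ∧ (x k - a) / (b - a) ≤ 1 := by
  have h1 := hx.1 k
  have h2 := hx.2 k
  simp only at h1 h2
  refine ⟨div_nonneg (by linarith) (by linarith), ?_⟩
  rw [div_le_one (by linarith)]
  linarith

lemma mw_nonneg {a b : ℝ} (hab : a < b) {d : ℕ} (N : Fin d → ℕ) (j : Fin d → ℤ) {x : Fin d → ℝ}
    (hx : x ∈ Set.Icc (fun _ : Fin d => a) (fun _ => b)) : 0 ≤ mw a b N j x :=
  Finset.prod_nonneg fun k _ => qw_nonneg _ _ (unit_mem hab hx k).1 (unit_mem hab hx k).2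

lemma mw_sum (a b : ℝ) {d : ℕ} (n : ℕ) (N : Fin d → ℕ) (hN : ∀ k, N k ≤ n) (x : Fin d → ℝ) :
    ∑ j : Fin d → Fin (n + 1), mw a b N (zc j) x = 1 := by
  have := Finset.prod_univ_sum (fun _ : Fin d => (Finset.univ : Finset (Fin (n + 1))))
    (fun k j => qw (N k) ((j : ℕ) : ℤ) ((x k - a) / (b - a)))
  rw [Fintype.piFinset_univ] at this
  simp only [mw, zc]
  rw [← this]
  exact Finset.prod_eq_one fun k _ => qw_sum _ _ (hN k) _

lemma mw_sum_coord (a b : ℝ) {d : ℕ} (n : ℕ) (N : Fin d → ℕ) (hN : ∀ k, N k ≤ n)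
    (x : Fin d → ℝ) (i : Fin d) (g : ℤ → ℝ) :
    ∑ j : Fin d → Fin (n + 1), g (zc j i) * mw a b N (zc j) x =
      ∑ j : Fin (n + 1), g ((j : ℕ) : ℤ) * qw (N i) ((j : ℕ) : ℤ) ((x i - a) / (b - a)) := by
  have := Finset.prod_univ_sum (fun _ : Fin d => (Finset.univ : Finset (Fin (n + 1))))
    (fun k j => (if k = i then g ((j : ℕ) : ℤ) else 1) *
      qw (N k) ((j : ℕ) : ℤ) ((x k - a) / (b - a)))
  rw [Fintype.piFinset_univ] at this
  have e : ∀ j : Fin d → Fin (n + 1), g (zc j i) * mw a b N (zc j) x =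
      ∏ k, ((if k = i then g ((j k : ℕ) : ℤ) else 1) *
      qw (N k) ((j k : ℕ) : ℤ) ((x k - a) / (b - a))) := by
    intro j
    rw [Finset.prod_mul_distrib, Finset.prod_ite_eq' Finset.univ i]
    simp [mw, zc]
  simp only [e]
  rw [← this, Finset.prod_eq_single i]
  · simp
  · intro k _ hk
    simp only [hk, if_false, one_mul]
    exact qw_sum _ _ (hN k) _
  · simp

lemma mw_shift (a b : ℝ) {d : ℕ} (n : ℕ) (N : Fin d → ℕ) (i : Fin d) (hN : ∀ k, N k ≤ n)
    (hi : N i + 1 ≤ n) (x : Fin d → ℝ) (g : (Fin d → ℤ) → ℝ) :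
    ∑ j : Fin d → Fin (n + 1), g (zc j) * mw a b N (zc j - (Pi.single i 1 : Fin d → ℤ)) x =
      ∑ j : Fin d → Fin (n + 1), g (zc j + (Pi.single i 1 : Fin d → ℤ)) * mw a b N (zc j) x := by
  have key : ∀ G : (Fin d → ℤ) → ℝ, (∀ j, (∃ k, ¬ (0 ≤ j k ∧ j k ≤ (n : ℤ))) → G j = 0) →
      ∑ j : Fin d → Fin (n + 1), G (zc j) = ∑ᶠ j, G j := by
    intro G hG
    rw [finsum_eq_sum_of_support_subset (s := Finset.univ.image zc),
      Finset.sum_image (fun _ _ _ _ h => zc_injective d n h)]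
    intro j hj
    by_contra hcon
    apply hj
    apply hG
    by_contra hh
    push Not at hh
    apply hcon
    simp only [Finset.coe_image, Finset.coe_univ, Set.image_univ, Set.mem_range]
    refine ⟨fun k => ⟨(j k).toNat, ?_⟩, ?_⟩
    · have := hh k
      omega
    · funext k
      have := hh k
      simp only [zc]
      omega
  rw [key (fun j => g j * mw a b N (j - (Pi.single i 1 : Fin d → ℤ)) x),
    key (fun j => g (j + (Pi.single i 1 : Fin d → ℤ)) * mw a b N j x)]
  · rw [← finsum_comp_equiv (Equiv.addRight (Pi.single i (1 : ℤ)))]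
    simp
  · rintro j ⟨k, hk⟩
    rw [mw_eq_zero a b (k := k), mul_zero]
    have := hN k
    omega
  · rintro j ⟨k, hk⟩
    rw [mw_eq_zero a b (k := k), mul_zero]
    have h1 := hN k
    by_cases hki : k = i
    · subst hki
      simp
      omega
    · simp [hki]
      omega

lemma mw_hasFDerivAt (a b : ℝ) {d : ℕ} (N : Fin d → ℕ) (j : Fin d → ℤ) (x : Fin d → ℝ) :
    DifferentiableAt ℝ (mw a b N j) x := by
  unfold mw
  have : ∀ k, DifferentiableAt ℝ (fun y : Fin d → ℝ => qw (N k) (j k) ((y k - a) / (b - a))) x := by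
    intro k
    have h1 := (qw_hasDerivAt (N k) (j k) ((x k - a) / (b - a))).differentiableAt
    have h2 : DifferentiableAt ℝ (fun y : Fin d → ℝ => (y k - a) / (b - a)) x := by fun_prop
    exact DifferentiableAt.comp (g := qw (N k) (j k)) x h1 h2
  exact (HasFDerivAt.finsetProd (u := Finset.univ) fun k _ => (this k).hasFDerivAt).differentiableAt

lemma mw_pder (a b : ℝ) {d : ℕ} (N : Fin d → ℕ) (j : Fin d → ℤ) (i : Fin d) (x : Fin d → ℝ) :
    pder d i (mw a b N j) x = (N i / (b - a)) *
      (mw a b (Function.update N i (N i - 1)) (j - (Pi.single i 1 : Fin d → ℤ)) x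
        - mw a b (Function.update N i (N i - 1)) j x) := by
  have h1 : pder d i (mw a b N j) x = lineDeriv ℝ (mw a b N j) x (Pi.single i 1) :=
    ((mw_hasFDerivAt a b N j x).lineDeriv_eq_fderiv).symm
  rw [h1]
  apply HasLineDerivAt.lineDeriv
  unfold HasLineDerivAt
  have e : (fun t : ℝ => mw a b N j (x + t • Pi.single i 1)) = fun t =>
      (∏ k ∈ Finset.univ.erase i, qw (N k) (j k) ((x k - a) / (b - a))) *
        qw (N i) (j i) ((x i + t - a) / (b - a)) := by
    funext t
    unfold mw
    rw [← Finset.prod_erase_mul _ _ (Finset.mem_univ i)]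
    congr 1
    · apply Finset.prod_congr rfl
      intro k hk
      simp [(Finset.mem_erase.1 hk).1]
    · simp
  rw [e]
  have hin : HasDerivAt (fun t : ℝ => (x i + t - a) / (b - a)) (1 / (b - a)) 0 := by
    apply HasDerivAt.div_const
    simpa using ((hasDerivAt_id (0 : ℝ)).const_add (x i)).sub_const a
  have h0 : (x i + 0 - a) / (b - a) = (x i - a) / (b - a) := by rw [add_zero]
  have hq := qw_hasDerivAt (N i) (j i) ((x i + 0 - a) / (b - a))
  have := (HasDerivAt.comp (0 : ℝ) hq hin).const_mul
    (∏ k ∈ Finset.univ.erase i, qw (N k) (j k) ((x k - a) / (b - a)))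
  refine this.congr_deriv ?_
  rw [h0]
  unfold mw
  rw [← Finset.prod_erase_mul _ _ (Finset.mem_univ i), ← Finset.prod_erase_mul _ _ (Finset.mem_univ i)]
  have e1 : ∀ s : ℤ, ∏ k ∈ Finset.univ.erase i, qw (Function.update N i (N i - 1) k)
      ((j - (Pi.single i s : Fin d → ℤ)) k) ((x k - a) / (b - a)) =
      ∏ k ∈ Finset.univ.erase i, qw (N k) (j k) ((x k - a) / (b - a)) := by
    intro s
    apply Finset.prod_congr rfl
    intro k hk
    simp [(Finset.mem_erase.1 hk).1]
  have e2 := e1 0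
  simp only [Pi.single_zero, sub_zero] at e2
  rw [e1 1, e2]
  simp
  ring

/-- iterated partial derivatives along a list of directions -/
def pderL {d : ℕ} (L : List (Fin d)) (f : (Fin d → ℝ) → ℝ) : (Fin d → ℝ) → ℝ :=
  L.foldr (pder d) f

/-- forward difference -/
def fdiff {d : ℕ} (h : ℝ) (i : Fin d) (f : (Fin d → ℝ) → ℝ) : (Fin d → ℝ) → ℝ :=
  fun y => f (y + Pi.single i h) - f y

/-- iterated forward differences -/
def fdiffL {d : ℕ} (h : ℝ) (L : List (Fin d)) (f : (Fin d → ℝ) → ℝ) : (Fin d → ℝ) → ℝ :=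
  L.foldr (fdiff h) f

/-- lattice nodes -/
def znode (a h : ℝ) {d : ℕ} (j : Fin d → ℤ) : Fin d → ℝ := fun k => a + (j k : ℝ) * h

lemma znode_add (a h : ℝ) {d : ℕ} (j : Fin d → ℤ) (i : Fin d) :
    znode a h (j + (Pi.single i 1 : Fin d → ℤ)) = znode a h j + Pi.single i h := by
  funext k
  by_cases hk : k = i
  · subst hk
    simp [znode]; ring
  · simp [znode, hk]

/-- Generalized Bernstein sum -/
def bsum (a b h : ℝ) {d : ℕ} (n : ℕ) (N : Fin d → ℕ) (f : (Fin d → ℝ) → ℝ) (x : Fin d → ℝ) : ℝ :=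
  ∑ j : Fin d → Fin (n + 1), f (znode a h (zc j)) * mw a b N (zc j) x

lemma pder_const_mul {d : ℕ} (i : Fin d) (c : ℝ) {f : (Fin d → ℝ) → ℝ} (x : Fin d → ℝ)
    (hf : DifferentiableAt ℝ f x) : pder d i (fun y => c * f y) x = c * pder d i f x := by
  unfold pder
  rw [fderiv_const_mul hf]
  simp

lemma bsum_diff (a b h : ℝ) {d : ℕ} (n : ℕ) (N : Fin d → ℕ) (f : (Fin d → ℝ) → ℝ)
    (x : Fin d → ℝ) : DifferentiableAt ℝ (bsum a b h n N f) x := by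
  unfold bsum
  exact DifferentiableAt.fun_sum fun j _ => (mw_hasFDerivAt a b N (zc j) x).const_mul _

lemma pder_bsum (a b h : ℝ) {d : ℕ} (n : ℕ) (N : Fin d → ℕ) (hN : ∀ k, N k ≤ n) (i : Fin d)
    (f : (Fin d → ℝ) → ℝ) (x : Fin d → ℝ) :
    pder d i (bsum a b h n N f) x =
      (N i / (b - a)) * bsum a b h n (Function.update N i (N i - 1)) (fdiff h i f) x := by
  have h1 : pder d i (bsum a b h n N f) x =
      ∑ j : Fin d → Fin (n + 1), f (znode a h (zc j)) * pder d i (mw a b N (zc j)) x := by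
    unfold bsum
    conv_lhs => unfold pder
    rw [fderiv_fun_sum fun j _ => (mw_hasFDerivAt a b N (zc j) x).const_mul _]
    rw [_root_.sum_apply]
    refine Finset.sum_congr rfl fun j _ => ?_
    exact pder_const_mul i _ x (mw_hasFDerivAt a b N (zc j) x)
  rw [h1]
  simp only [mw_pder]
  rcases Nat.eq_zero_or_pos (N i) with h0 | h0
  · simp [h0]
  have h2 := mw_shift a b n (Function.update N i (N i - 1)) i (by
    intro k
    by_cases hk : k = i
    · subst hk; simp; have := hN k; omega
    · simp [hk, hN k]) (by simp; have := hN i; omega) x (fun j => f (znode a h j))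
  simp only [znode_add] at h2
  unfold bsum fdiff
  rw [Finset.mul_sum]
  simp only [sub_mul, mul_sub, Finset.sum_sub_distrib]
  simp only [mul_left_comm (f _) ((N i : ℝ) / (b - a))]
  rw [← Finset.mul_sum, h2, Finset.mul_sum]

/-- scalar factor -/
def rfac {d : ℕ} (s : ℝ) (n : ℕ) : List (Fin d) → ℝ
  | [] => 1
  | i :: L => ((n - L.count i : ℕ) : ℝ) / s * rfac s n L

lemma pderL_bsum (a b h : ℝ) {d : ℕ} (n : ℕ) (L : List (Fin d)) (f : (Fin d → ℝ) → ℝ) :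
    pderL L (bsum a b h n (fun _ => n) f) =
      fun x => rfac (b - a) n L * bsum a b h n (fun k => n - L.count k) (fdiffL h L f) x := by
  induction L with
  | nil => simp [pderL, fdiffL, rfac]
  | cons i L ih =>
    have : pderL (i :: L) (bsum a b h n (fun _ => n) f) =
      pder d i (pderL L (bsum a b h n (fun _ => n) f)) := rfl
    rw [this, ih]
    funext x
    rw [pder_const_mul i _ x (bsum_diff ..), pder_bsum _ _ _ _ _ (by intro k; omega)]
    have e : Function.update (fun k => n - L.count k) i (n - L.count i - 1) =
        fun k => n - (i :: L).count k := by
      funext k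
      by_cases hk : k = i
      · subst hk; simp; omega
      · simp [hk, List.count_cons_of_ne (Ne.symm hk)]
    rw [e]
    simp only [rfac]
    have : fdiffL h (i :: L) f = fdiff h i (fdiffL h L f) := rfl
    rw [this]
    ring

lemma rfac_mul {d : ℕ} {s : ℝ} (hs : s ≠ 0) (n : ℕ) (L : List (Fin d)) :
    rfac s n L * (s / n) ^ L.length = rfac n n L := by
  induction L with
  | nil => simp [rfac]
  | cons i L ih =>
    simp only [rfac, List.length_cons, pow_succ]
    rw [← ih]
    field_simp

lemma rfac_tendsto {d : ℕ} (L : List (Fin d)) :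
    Tendsto (fun n : ℕ => rfac (n : ℝ) n L) atTop (𝓝 1) := by
  induction L with
  | nil => simp [rfac]
  | cons i L ih =>
    simp only [rfac]
    have : Tendsto (fun n : ℕ => ((n - L.count i : ℕ) : ℝ) / n) atTop (𝓝 1) := by
      have h1 : Tendsto (fun n : ℕ => 1 - (L.count i : ℝ) / n) atTop (𝓝 (1 - 0)) :=
        tendsto_const_nhds.sub (tendsto_const_div_atTop_nhds_zero_nat _)
      rw [sub_zero] at h1
      refine h1.congr' ?_
      filter_upwards [eventually_ge_atTop (L.count i + 1)] with n hn
      rw [Nat.cast_sub (by omega)]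
      have : (n : ℝ) ≠ 0 := by
        have : n ≠ 0 := by omega
        exact_mod_cast this
      field_simp
    simpa using this.mul ih

lemma rfac_nonneg {d : ℕ} (n : ℕ) (L : List (Fin d)) : 0 ≤ rfac (n : ℝ) n L := by
  induction L with
  | nil => simp [rfac]
  | cons i L ih => simp only [rfac]; positivity

lemma rfac_le_one {d : ℕ} (n : ℕ) (L : List (Fin d)) : rfac (n : ℝ) n L ≤ 1 := by
  induction L with
  | nil => simp [rfac]
  | cons i L ih =>
    simp only [rfac]
    refine mul_le_one₀ ?_ (rfac_nonneg n L) ih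
    apply div_le_one_of_le₀ _ (Nat.cast_nonneg n)
    exact_mod_cast Nat.sub_le _ _

lemma fdiff_comm {d : ℕ} (h : ℝ) (i j : Fin d) (f : (Fin d → ℝ) → ℝ) :
    fdiff h i (fdiff h j f) = fdiff h j (fdiff h i f) := by
  funext y
  simp only [fdiff]
  rw [add_right_comm]
  ring

lemma fdiffL_append {d : ℕ} (h : ℝ) (L : List (Fin d)) (i : Fin d) (f : (Fin d → ℝ) → ℝ) :
    fdiffL h (L ++ [i]) f = fdiff h i (fdiffL h L f) := by
  have : fdiffL h (L ++ [i]) f = fdiffL h L (fdiff h i f) := by simp [fdiffL]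
  rw [this]
  induction L with
  | nil => rfl
  | cons j L ih =>
    change fdiff h j (fdiffL h L (fdiff h i f)) = fdiff h i (fdiff h j (fdiffL h L f))
    rw [ih (by simp [fdiffL]), fdiff_comm]

lemma fdiff_diff {d : ℕ} (h : ℝ) (i : Fin d) {f : (Fin d → ℝ) → ℝ} (hf : Differentiable ℝ f) :
    Differentiable ℝ (fdiff h i f) := by
  unfold fdiff
  fun_prop

lemma pder_fdiff {d : ℕ} (h : ℝ) (i j : Fin d) {f : (Fin d → ℝ) → ℝ} (hf : Differentiable ℝ f) :
    pder d i (fdiff h j f) = fdiff h j (pder d i f) := by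
  funext x
  unfold pder fdiff
  rw [fderiv_fun_sub (by fun_prop) (by fun_prop), fderiv_comp_add_right]
  rfl

lemma fdiffL_diff {d : ℕ} (h : ℝ) (L : List (Fin d)) {f : (Fin d → ℝ) → ℝ}
    (hf : Differentiable ℝ f) : Differentiable ℝ (fdiffL h L f) := by
  induction L with
  | nil => exact hf
  | cons j L ih => exact fdiff_diff h j ih

lemma pder_fdiffL {d : ℕ} (h : ℝ) (i : Fin d) (L : List (Fin d)) {f : (Fin d → ℝ) → ℝ}
    (hf : Differentiable ℝ f) : pder d i (fdiffL h L f) = fdiffL h L (pder d i f) := by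
  induction L with
  | nil => rfl
  | cons j L ih =>
    change pder d i (fdiff h j (fdiffL h L f)) = fdiff h j (fdiffL h L (pder d i f))
    rw [pder_fdiff h i j (fdiffL_diff h L hf), ih]

lemma fdiff_mvt {d : ℕ} {h : ℝ} (hh : 0 ≤ h) (i : Fin d) {f : (Fin d → ℝ) → ℝ}
    (hf : Differentiable ℝ f) (y : Fin d → ℝ) :
    ∃ s, 0 ≤ s ∧ s ≤ h ∧ fdiff h i f y = h * pder d i f (y + Pi.single i s) := by
  rcases hh.eq_or_lt with h0 | h0
  · subst h0
    exact ⟨0, le_rfl, le_rfl, by simp [fdiff]⟩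
  have hd : ∀ s, HasDerivAt (fun s : ℝ => f (y + Pi.single i s)) (pder d i f (y + Pi.single i s)) s := by
    intro s
    have h1 : HasDerivAt (fun s : ℝ => y + Pi.single i s) (Pi.single i (1 : ℝ)) s :=
      (hasDerivAt_single i s).const_add y
    exact (hf (y + Pi.single i s)).hasFDerivAt.comp_hasDerivAt s h1
  obtain ⟨s, hs, he⟩ := exists_hasDerivAt_eq_slope (fun s : ℝ => f (y + Pi.single i s)) _ h0
    (fun s _ => (hd s).continuousAt.continuousWithinAt) (fun s _ => hd s)
  refine ⟨s, hs.1.le, hs.2.le, ?_⟩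
  rw [he]
  simp only [fdiff, Pi.single_zero, add_zero, sub_zero]
  field_simp

lemma pder_contDiff {d : ℕ} (i : Fin d) {m : ℕ} {f : (Fin d → ℝ) → ℝ}
    (hf : ContDiff ℝ (m + 1 : ℕ) f) : ContDiff ℝ m (pder d i f) := by
  unfold pder
  have := hf.fderiv_right (m := (m : ℕ)) (by norm_cast)
  exact this.clm_apply contDiff_const

lemma fdiffL_mvt {d : ℕ} {h : ℝ} (hh : 0 ≤ h) (L : List (Fin d)) {f : (Fin d → ℝ) → ℝ}
    (hf : ContDiff ℝ L.length f) (y : Fin d → ℝ) :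
    ∃ ξ : Fin d → ℝ, (∀ k, y k ≤ ξ k ∧ ξ k ≤ y k + L.count k * h) ∧
      fdiffL h L f y = h ^ L.length * pderL L f ξ := by
  induction L using List.reverseRecOn generalizing f y with
  | nil => exact ⟨y, by simp, by simp [fdiffL, pderL]⟩
  | append_singleton L i ih =>
    rw [List.length_append, List.length_singleton] at hf
    have hfd : Differentiable ℝ f := hf.differentiable (by norm_cast)
    rw [fdiffL_append]
    obtain ⟨s, hs0, hs1, hs⟩ := fdiff_mvt hh i (fdiffL_diff h L hfd) y
    rw [pder_fdiffL h i L hfd] at hs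
    obtain ⟨ξ, hξ, he⟩ := ih (pder_contDiff i hf) (y + Pi.single i s)
    refine ⟨ξ, ?_, ?_⟩
    · intro k
      have := hξ k
      by_cases hk : k = i
      · subst hk
        simp at this ⊢
        constructor <;> nlinarith
      · have h2 : List.count k [i] = 0 := by simp [Ne.symm hk]
        simp [hk] at this
        rw [List.count_append, h2]
        simpa using this
    · rw [hs, he]
      have : pderL (L ++ [i]) f = pderL L (pder d i f) := by simp [pderL]
      rw [this]
      simp only [List.length_append, List.length_singleton, pow_succ]
      ring

lemma multiDeriv_eq_pderL {d : ℕ} (l : Fin d → ℕ) (f : (Fin d → ℝ) → ℝ) :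
    multiDeriv d l f = pderL ((List.finRange d).flatMap fun i => List.replicate (l i) i) f := by
  unfold multiDeriv pderL
  induction List.finRange d with
  | nil => rfl
  | cons i S ih =>
    rw [List.foldr_cons, ih, List.flatMap_cons, List.foldr_append]
    generalize List.foldr (pder d) f _ = g
    induction l i with
    | zero => rfl
    | succ k ihk => rw [Function.iterate_succ_apply', ihk, List.replicate_succ, List.foldr_cons]

lemma length_list {d : ℕ} (l : Fin d → ℕ) :
    ((List.finRange d).flatMap fun i => List.replicate (l i) i).length = ∑ i, l i := by
  rw [List.length_flatMap, Fin.sum_univ_def]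
  simp

lemma key_est {a b : ℝ} (hab : a < b) {d : ℕ} (L : List (Fin d)) {f : (Fin d → ℝ) → ℝ}
    (hf : ContDiff ℝ L.length f) {n : ℕ} (hn : 1 ≤ n) (hL : L.length ≤ n) {x : Fin d → ℝ}
    (hx : x ∈ Set.Icc (fun _ : Fin d => a) (fun _ => b)) {A ε M δ : ℝ} (hδ : 0 < δ) (hM : 0 ≤ M)
    (hε0 : 0 ≤ ε)
    (hb : ∀ ξ ∈ Set.Icc (fun _ : Fin d => a) (fun _ => b), |pderL L f ξ - A| ≤ M)
    (hε : ∀ ξ ∈ Set.Icc (fun _ : Fin d => a) (fun _ => b), dist ξ x < δ → |pderL L f ξ - A| ≤ ε) :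
    |pderL L (bsum a b ((b - a) / n) n (fun _ => n) f) x - rfac (n : ℝ) n L * A| ≤
      ε + M / δ ^ 2 * (d * (((b - a) / n) ^ 2 * (2 * n + 6 * (L.length : ℝ) ^ 2))) := by
  have hn0 : (0 : ℝ) < n := by exact_mod_cast hn
  set h : ℝ := (b - a) / n with hh
  have hh0 : 0 < h := div_pos (by linarith) hn0
  have hnh : n * h = b - a := by rw [hh]; field_simp
  set N : Fin d → ℕ := fun k => n - L.count k with hNdef
  have hN : ∀ k, N k ≤ n := fun k => by simp only [hNdef]; omega
  have hc : ∀ k, L.count k ≤ L.length := fun k => List.count_le_length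
  set t : Fin d → ℝ := fun k => (x k - a) / (b - a) with ht
  have hxt : ∀ k, x k = a + n * h * t k := by
    intro k
    rw [hnh, ht]
    have : b - a ≠ 0 := by linarith
    field_simp
    ring
  have hmv := fun j : Fin d → Fin (n + 1) => fdiffL_mvt hh0.le L hf (znode a h (zc j))
  choose ξ hξ hξe using hmv
  have hW : ∀ j : Fin d → Fin (n + 1), 0 ≤ mw a b N (zc j) x := fun j => mw_nonneg hab N _ hx
  have hS : ∑ j : Fin d → Fin (n + 1), mw a b N (zc j) x = 1 := mw_sum a b n N hN x
  have hrep : pderL L (bsum a b h n (fun _ => n) f) x - rfac (n : ℝ) n L * A =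
      rfac (n : ℝ) n L * ∑ j : Fin d → Fin (n + 1), (pderL L f (ξ j) - A) * mw a b N (zc j) x := by
    rw [pderL_bsum]
    simp only [bsum, hξe, sub_mul, Finset.sum_sub_distrib, ← Finset.mul_sum, hS, mul_assoc]
    rw [← mul_assoc, rfac_mul (by linarith)]
    ring
  have hterm : ∀ j : Fin d → Fin (n + 1), |(pderL L f (ξ j) - A) * mw a b N (zc j) x| ≤
      (ε + M / δ ^ 2 * ∑ k, h ^ 2 * (2 * (n * t k - (zc j k : ℝ)) ^ 2 + 2 * (L.length : ℝ) ^ 2))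
        * mw a b N (zc j) x := by
    intro j
    by_cases hz : mw a b N (zc j) x = 0
    · simp [hz]
    rw [abs_mul, abs_of_nonneg (hW j)]
    refine mul_le_mul_of_nonneg_right ?_ (hW j)
    have hj : ∀ k, 0 ≤ zc j k ∧ zc j k ≤ N k := by
      intro k
      by_contra hcon
      exact hz (mw_eq_zero a b hcon x)
    have hξK : ξ j ∈ Set.Icc (fun _ : Fin d => a) (fun _ => b) := by
      constructor
      · intro k
        have h1 := (hξ j k).1
        have h2 : (0 : ℝ) ≤ (zc j k : ℝ) := by exact_mod_cast (hj k).1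
        simp only [znode] at h1
        simp only
        nlinarith [mul_nonneg h2 hh0.le]
      · intro k
        have h1 := (hξ j k).2
        have h2 : (zc j k : ℝ) + L.count k ≤ n := by
          have := (hj k).2
          have h3 := hc k
          simp only [hNdef] at this
          have : zc j k + L.count k ≤ n := by omega
          exact_mod_cast this
        simp only [znode] at h1
        simp only
        nlinarith [mul_le_mul_of_nonneg_right h2 hh0.le]
    have hsq : ∀ k, (ξ j k - x k) ^ 2 ≤
        h ^ 2 * (2 * (n * t k - (zc j k : ℝ)) ^ 2 + 2 * (L.length : ℝ) ^ 2) := by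
      intro k
      obtain ⟨h1, h2⟩ := hξ j k
      have h3 : (L.count k : ℝ) * h ≤ L.length * h :=
        mul_le_mul_of_nonneg_right (by exact_mod_cast hc k) hh0.le
      simp only [znode] at h1 h2
      set e := ξ j k - (a + zc j k * h) with he
      have e0 : 0 ≤ e := by linarith
      have e1 : e ≤ L.length * h := by linarith
      have e2 : ξ j k - x k = e - h * (n * t k - zc j k) := by
        rw [hxt k, he]; ring
      have e3 : e ^ 2 ≤ (L.length * h) ^ 2 := pow_le_pow_left₀ e0 e1 2
      rw [e2]
      nlinarith [sq_nonneg (e + h * (n * t k - zc j k))]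
    have hsum0 : ∑ k, (ξ j k - x k) ^ 2 ≤
        ∑ k, h ^ 2 * (2 * (n * t k - (zc j k : ℝ)) ^ 2 + 2 * (L.length : ℝ) ^ 2) :=
      Finset.sum_le_sum fun k _ => hsq k
    have hMd : 0 ≤ M / δ ^ 2 := by positivity
    by_cases hd : dist (ξ j) x < δ
    · have := hε _ hξK hd
      have h2 : 0 ≤ ∑ k, (ξ j k - x k) ^ 2 := Finset.sum_nonneg fun k _ => sq_nonneg _
      nlinarith [mul_nonneg hMd (h2.trans hsum0)]
    · have h1 := hb _ hξK
      have h2 : δ ^ 2 ≤ ∑ k, (ξ j k - x k) ^ 2 := by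
        rw [dist_pi_lt_iff hδ] at hd
        push Not at hd
        obtain ⟨k, hk⟩ := hd
        rw [Real.dist_eq] at hk
        calc δ ^ 2 ≤ |ξ j k - x k| ^ 2 := pow_le_pow_left₀ hδ.le hk 2
          _ = (ξ j k - x k) ^ 2 := sq_abs _
          _ ≤ _ := Finset.single_le_sum (f := fun k => (ξ j k - x k) ^ 2)
            (fun k _ => sq_nonneg _) (Finset.mem_univ k)
      have h3 := mul_le_mul_of_nonneg_left (h2.trans hsum0) hMd
      have h4 : M / δ ^ 2 * δ ^ 2 = M := by field_simp
      linarith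
  have hvar : ∀ k, ∑ j : Fin d → Fin (n + 1), (h ^ 2 * (2 * (n * t k - (zc j k : ℝ)) ^ 2 +
      2 * (L.length : ℝ) ^ 2)) * mw a b N (zc j) x ≤ h ^ 2 * (2 * n + 6 * (L.length : ℝ) ^ 2) := by
    intro k
    have h1 := mw_sum_coord a b n N hN x k
      (fun z => h ^ 2 * (2 * (n * t k - (z : ℝ)) ^ 2 + 2 * (L.length : ℝ) ^ 2))
    rw [h1]
    have h2 := qw_var_le (N k) n (L.count k) (by simp only [hNdef]; have := hc k; omega)
      (unit_mem hab hx k).1 (unit_mem hab hx k).2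
    have h3 := qw_sum (N k) n (hN k) ((x k - a) / (b - a))
    have h4 : (L.count k : ℝ) ^ 2 ≤ (L.length : ℝ) ^ 2 :=
      pow_le_pow_left₀ (Nat.cast_nonneg _) (by exact_mod_cast hc k) 2
    have h5 : ∑ j : Fin (n + 1), h ^ 2 * (2 * (n * t k - (((j : ℕ) : ℤ) : ℝ)) ^ 2 +
        2 * (L.length : ℝ) ^ 2) * qw (N k) ((j : ℕ) : ℤ) ((x k - a) / (b - a)) =
        h ^ 2 * (2 * (∑ j : Fin (n + 1), ((n : ℝ) * t k - ((j : ℕ) : ℝ)) ^ 2 *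
          qw (N k) ((j : ℕ) : ℤ) (t k)) + 2 * (L.length : ℝ) ^ 2 *
          ∑ j : Fin (n + 1), qw (N k) ((j : ℕ) : ℤ) ((x k - a) / (b - a))) := by
      rw [mul_add, Finset.mul_sum, Finset.mul_sum, Finset.mul_sum, Finset.mul_sum,
        ← Finset.sum_add_distrib]
      refine Finset.sum_congr rfl fun j _ => ?_
      simp only [ht, Int.cast_natCast]
      ring
    rw [h5, h3]
    refine mul_le_mul_of_nonneg_left ?_ (sq_nonneg h)
    linarith
  have htot : |∑ j : Fin d → Fin (n + 1), (pderL L f (ξ j) - A) * mw a b N (zc j) x| ≤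
      ε + M / δ ^ 2 * (d * (h ^ 2 * (2 * n + 6 * (L.length : ℝ) ^ 2))) := by
    refine (Finset.abs_sum_le_sum_abs _ _).trans ((Finset.sum_le_sum fun j _ => hterm j).trans ?_)
    have e : ∀ S : (Fin d → Fin (n + 1)) → ℝ, ∑ j : Fin d → Fin (n + 1),
        (ε + M / δ ^ 2 * S j) * mw a b N (zc j) x =
        ε + M / δ ^ 2 * ∑ j : Fin d → Fin (n + 1), S j * mw a b N (zc j) x := by
      intro S
      have e1 : ∀ j, (ε + M / δ ^ 2 * S j) * mw a b N (zc j) x =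
          ε * mw a b N (zc j) x + M / δ ^ 2 * (S j * mw a b N (zc j) x) := fun j => by ring
      rw [Finset.sum_congr rfl fun j _ => e1 j, Finset.sum_add_distrib, ← Finset.mul_sum,
        ← Finset.mul_sum, hS, mul_one]
    rw [e]
    refine add_le_add le_rfl (mul_le_mul_of_nonneg_left ?_ (by positivity))
    simp only [Finset.sum_mul]
    rw [Finset.sum_comm]
    refine (Finset.sum_le_sum fun k _ => hvar k).trans ?_
    simp
  rw [hrep, abs_mul, abs_of_nonneg (rfac_nonneg n L)]
  exact (mul_le_of_le_one_left (abs_nonneg _) (rfac_le_one n L)).trans htot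

lemma err_tendsto (a b c M : ℝ) (d : ℕ) :
    Tendsto (fun n : ℕ => M * (d * (((b - a) / n) ^ 2 * (2 * n + 6 * c ^ 2)))) atTop (𝓝 0) := by
  have h1 : Tendsto (fun n : ℕ => (b - a) / (n : ℝ)) atTop (𝓝 0) :=
    tendsto_const_div_atTop_nhds_zero_nat _
  have h2 : Tendsto (fun n : ℕ => M * (d * (2 * (b - a) * ((b - a) / (n : ℝ)) +
      6 * c ^ 2 * ((b - a) / (n : ℝ)) ^ 2))) atTop
      (𝓝 (M * (d * (2 * (b - a) * 0 + 6 * c ^ 2 * 0 ^ 2)))) :=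
    (((h1.const_mul _).add ((h1.pow 2).const_mul _)).const_mul _).const_mul _
  have e : (M * (d * (2 * (b - a) * 0 + 6 * c ^ 2 * 0 ^ 2))) = 0 := by ring
  rw [e] at h2
  refine h2.congr' ?_
  filter_upwards [eventually_ge_atTop 1] with n hn
  have : (n : ℝ) ≠ 0 := by
    have : n ≠ 0 := by omega
    exact_mod_cast this
  field_simp

lemma bpoly_eq_mw {a b : ℝ} (hab : a < b) {d n : ℕ} (j : Fin d → Fin (n + 1)) (x : Fin d → ℝ) :
    bpoly a b d n j x = mw a b (fun _ => n) (zc j) x := by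
  have hne : b - a ≠ 0 := by linarith
  unfold bpoly mw
  rw [pow_mul]
  have : ((b - a)⁻¹ ^ n) ^ d = ∏ _k : Fin d, (b - a)⁻¹ ^ n := by simp
  rw [this, ← Finset.prod_mul_distrib]
  refine Finset.prod_congr rfl fun k _ => ?_
  simp only [zc, qw_natCast, bernsteinPolynomial, Polynomial.eval_mul, Polynomial.eval_pow,
    Polynomial.eval_X, Polynomial.eval_sub, Polynomial.eval_one, Polynomial.eval_natCast]
  have e : 1 - (x k - a) / (b - a) = (b - x k) / (b - a) := by field_simp; ring
  rw [e, div_pow, div_pow]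
  have hk : (j k : ℕ) + (n - (j k : ℕ)) = n := by have := (j k).2; omega
  have : (b - a)⁻¹ ^ n = ((b - a) ^ (j k : ℕ))⁻¹ * ((b - a) ^ (n - (j k : ℕ)))⁻¹ := by
    rw [← mul_inv, ← pow_add, hk, inv_pow]
  rw [this]
  field_simp

lemma bnode_eq_znode (a b : ℝ) {d n : ℕ} (j : Fin d → Fin (n + 1)) :
    bnode a b d n j = znode a ((b - a) / n) (zc j) := by
  funext k
  simp [bnode, znode, zc]
  ring

lemma bern_eq_bsum {a b : ℝ} (hab : a < b) (d n : ℕ) (f : (Fin d → ℝ) → ℝ) :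
    (fun y => ∑ j : Fin d → Fin (n + 1), f (bnode a b d n j) * bpoly a b d n j y) =
      bsum a b ((b - a) / n) n (fun _ => n) f := by
  funext y
  simp only [bsum, bpoly_eq_mw hab, bnode_eq_znode]

lemma bern_unif {a b : ℝ} (hab : a < b) (d : ℕ) (g : BoundedContinuousFunction (Fin d → ℝ) ℝ)
    {ε : ℝ} (hε : 0 < ε) : ∀ᶠ n : ℕ in atTop, ∀ x ∈ Set.Icc (fun _ : Fin d => a) (fun _ => b),
      |bsum a b ((b - a) / n) n (fun _ => n) g x - g x| ≤ ε := by
  have hK : IsCompact (Set.Icc (fun _ : Fin d => a) (fun _ => b)) := isCompact_Icc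
  have huc := hK.uniformContinuousOn_of_continuous g.continuous.continuousOn
  rw [Metric.uniformContinuousOn_iff] at huc
  obtain ⟨δ, hδ, huc⟩ := huc (ε / 2) (by linarith)
  have herr := err_tendsto a b ((([] : List (Fin d)).length : ℕ) : ℝ) (2 * ‖g‖ / δ ^ 2) d
  filter_upwards [eventually_ge_atTop 1, herr.eventually_lt_const (half_pos hε)] with n hn he x hx
  have := key_est hab ([] : List (Fin d)) (f := g)
    (by simpa using (contDiff_zero (𝕜 := ℝ)).2 g.continuous) hn (by simp) hx (A := g x)
    (ε := ε / 2) (M := 2 * ‖g‖) hδ (by positivity) (by linarith)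
    (by
      intro ξ _
      have := g.dist_le_two_norm ξ x
      rwa [Real.dist_eq] at this)
    (by
      intro ξ hξ hd
      have := huc ξ hξ x hx hd
      rw [Real.dist_eq] at this
      exact this.le)
  simp only [rfac, one_mul] at this
  have e : pderL ([] : List (Fin d)) (bsum a b ((b - a) / n) n (fun _ => n) g) x =
    bsum a b ((b - a) / n) n (fun _ => n) g x := rfl
  rw [e] at this
  linarith

lemma ae_mem_of {d : ℕ} {K : Set (Fin d → ℝ)} {μ : FiniteMeasure (Fin d → ℝ)}
    (hμ : (μ : Measure (Fin d → ℝ)) Kᶜ = 0) : ∀ᵐ x ∂(μ : Measure (Fin d → ℝ)), x ∈ K := by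
  rw [ae_iff]
  exact hμ

lemma integrable_of_cont {d : ℕ} {K : Set (Fin d → ℝ)} (hK : IsCompact K)
    {μ : FiniteMeasure (Fin d → ℝ)} (hμ : (μ : Measure (Fin d → ℝ)) Kᶜ = 0)
    {f : (Fin d → ℝ) → ℝ} (hf : Continuous f) : Integrable f (μ : Measure (Fin d → ℝ)) := by
  have := hf.continuousOn.integrableOn_compact (μ := (μ : Measure (Fin d → ℝ))) hK
  rw [IntegrableOn, Measure.restrict_eq_self_of_ae_mem (ae_mem_of hμ)] at this
  exact this

lemma mw_continuous (a b : ℝ) {d : ℕ} (N : Fin d → ℕ) (j : Fin d → ℤ) :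
    Continuous (mw a b N j) :=
  (show Differentiable ℝ (mw a b N j) from fun x => mw_hasFDerivAt a b N j x).continuous

lemma chi_integral {a b : ℝ} (hab : a < b) (d n : ℕ) {μ : FiniteMeasure (Fin d → ℝ)}
    (hμ : (μ : Measure (Fin d → ℝ)) (Set.Icc (fun _ => a) (fun _ => b))ᶜ = 0)
    (g : BoundedContinuousFunction (Fin d → ℝ) ℝ) :
    ∫ x, g x ∂(chiB a b d n μ : Measure (Fin d → ℝ)) =
      ∫ x, bsum a b ((b - a) / n) n (fun _ => n) g x ∂(μ : Measure (Fin d → ℝ)) := by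
  unfold chiB bsum
  rw [FiniteMeasure.toMeasure_sum, integral_finsetSum_measure, integral_finsetSum]
  · refine Finset.sum_congr rfl fun j _ => ?_
    rw [FiniteMeasure.toMeasure_smul, integral_smul_nnreal_measure, integral_const_mul]
    have h1 : ∫ x, g x ∂((diracFM (bnode a b d n j) : FiniteMeasure (Fin d → ℝ)) :
      Measure (Fin d → ℝ)) = g (bnode a b d n j) := integral_dirac _ _
    rw [h1, bnode_eq_znode]
    simp only [bpoly_eq_mw hab]
    rw [NNReal.smul_def, Real.coe_toNNReal, smul_eq_mul, mul_comm]
    apply integral_nonneg_of_ae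
    filter_upwards [ae_mem_of hμ] with x hx
    exact mw_nonneg hab _ _ hx
  · intro j _
    exact (integrable_of_cont isCompact_Icc hμ (mw_continuous a b _ _)).const_mul _
  · intro j _
    exact g.integrable _

lemma bsum_one (a b h : ℝ) (d n : ℕ) (x : Fin d → ℝ) :
    bsum a b h n (fun _ => n) (fun _ => 1) x = 1 := by
  simp only [bsum, one_mul]
  exact mw_sum a b n _ (fun _ => le_rfl) x

lemma chi_mass {a b : ℝ} (hab : a < b) (d n : ℕ) {μ : FiniteMeasure (Fin d → ℝ)}
    (hμ : (μ : Measure (Fin d → ℝ)) (Set.Icc (fun _ => a) (fun _ => b))ᶜ = 0) :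
    (chiB a b d n μ).mass = μ.mass := by
  have := chi_integral hab d n hμ (BoundedContinuousFunction.const _ 1)
  have e : (⇑(BoundedContinuousFunction.const (Fin d → ℝ) (1 : ℝ))) = fun _ => (1 : ℝ) := rfl
  simp only [e, bsum_one] at this
  simp only [integral_const, smul_eq_mul, mul_one, FiniteMeasure.measureReal_eq_coe_coeFn] at this
  exact_mod_cast this

lemma chi_supp {a b : ℝ} (hab : a < b) (d n : ℕ) (μ : FiniteMeasure (Fin d → ℝ)) :
    (chiB a b d n μ : Measure (Fin d → ℝ)) (Set.Icc (fun _ => a) (fun _ => b))ᶜ = 0 := by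
  unfold chiB
  rw [FiniteMeasure.toMeasure_sum, Measure.finsetSum_apply]
  refine Finset.sum_eq_zero fun j _ => ?_
  rw [FiniteMeasure.toMeasure_smul, Measure.smul_apply]
  have h1 : ((diracFM (bnode a b d n j) : FiniteMeasure (Fin d → ℝ)) : Measure (Fin d → ℝ))
      (Set.Icc (fun _ => a) (fun _ => b))ᶜ = 0 := by
    change Measure.dirac _ _ = 0
    rw [Measure.dirac_apply' _ measurableSet_Icc.compl]
    simp only [Set.indicator_apply_eq_zero, Set.mem_compl_iff]
    intro hcon
    exfalso
    apply hcon
    have hba : 0 < b - a := by linarith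
    constructor
    · intro k
      simp only [bnode]
      have : 0 ≤ ((j k : ℕ) : ℝ) * (b - a) / n := by positivity
      linarith
    · intro k
      simp only [bnode]
      have h2 : ((j k : ℕ) : ℝ) / n ≤ 1 := by
        apply div_le_one_of_le₀ _ (Nat.cast_nonneg n)
        have := (j k).2
        exact_mod_cast (by omega : (j k : ℕ) ≤ n)
      have h3 : ((j k : ℕ) : ℝ) * (b - a) / n = ((j k : ℕ) : ℝ) / n * (b - a) := by ring
      nlinarith [mul_le_mul_of_nonneg_right h2 hba.le]
  rw [h1, smul_zero]

lemma chi_tendsto {a b : ℝ} (hab : a < b) (d : ℕ) (C : ℝ≥0) (μ₀ : FiniteMeasure (Fin d → ℝ)) :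
    Tendsto (fun p : ℕ × FiniteMeasure (Fin d → ℝ) => chiB a b d p.1 p.2)
      (atTop ×ˢ 𝓝[{μ : FiniteMeasure (Fin d → ℝ) |
        (μ : Measure (Fin d → ℝ)) (Set.Icc (fun _ => a) (fun _ => b))ᶜ = 0 ∧ μ.mass ≤ C}] μ₀)
      (𝓝 μ₀) := by
  rw [FiniteMeasure.tendsto_iff_forall_integral_tendsto]
  intro g
  set l := (atTop : Filter ℕ) ×ˢ 𝓝[{μ : FiniteMeasure (Fin d → ℝ) |
        (μ : Measure (Fin d → ℝ)) (Set.Icc (fun _ => a) (fun _ => b))ᶜ = 0 ∧ μ.mass ≤ C}] μ₀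
  have h1 : Tendsto (fun p : ℕ × FiniteMeasure (Fin d → ℝ) =>
      ∫ x, g x ∂(p.2 : Measure (Fin d → ℝ))) l (𝓝 (∫ x, g x ∂(μ₀ : Measure (Fin d → ℝ)))) := by
    have : Tendsto (fun p : ℕ × FiniteMeasure (Fin d → ℝ) => p.2) l (𝓝 μ₀) :=
      tendsto_snd.mono_right nhdsWithin_le_nhds
    exact (FiniteMeasure.tendsto_iff_forall_integral_tendsto.1 this) g
  have h2 : Tendsto (fun p : ℕ × FiniteMeasure (Fin d → ℝ) =>
      ∫ x, g x ∂(chiB a b d p.1 p.2 : Measure (Fin d → ℝ)) -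
      ∫ x, g x ∂(p.2 : Measure (Fin d → ℝ))) l (𝓝 0) := by
    rw [Metric.tendsto_nhds]
    intro ε hε
    have hC : 0 < (C : ℝ) + 1 := by positivity
    have e1 := bern_unif hab d g (ε := ε / 2 / ((C : ℝ) + 1)) (by positivity)
    have e2 : ∀ᶠ μ in 𝓝[{μ : FiniteMeasure (Fin d → ℝ) |
        (μ : Measure (Fin d → ℝ)) (Set.Icc (fun _ => a) (fun _ => b))ᶜ = 0 ∧ μ.mass ≤ C}] μ₀,
        μ ∈ {μ : FiniteMeasure (Fin d → ℝ) |
        (μ : Measure (Fin d → ℝ)) (Set.Icc (fun _ => a) (fun _ => b))ᶜ = 0 ∧ μ.mass ≤ C} :=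
      self_mem_nhdsWithin
    filter_upwards [e1.prod_mk e2] with p hp
    obtain ⟨hp1, hp2, hp3⟩ := hp
    rw [chi_integral hab d p.1 hp2 g, ← integral_sub, dist_zero_right]
    · have hb : ∀ᵐ x ∂(p.2 : Measure (Fin d → ℝ)),
          ‖bsum a b ((b - a) / p.1) p.1 (fun _ => p.1) g x - g x‖ ≤ ε / 2 / ((C : ℝ) + 1) := by
        filter_upwards [ae_mem_of hp2] with x hx
        exact hp1 x hx
      have := norm_integral_le_of_norm_le_const hb
      refine this.trans_lt ?_
      have h3 : (p.2 : Measure (Fin d → ℝ)).real Set.univ ≤ C := by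
        rw [FiniteMeasure.measureReal_eq_coe_coeFn]
        exact_mod_cast hp3
      calc ε / 2 / ((C : ℝ) + 1) * (p.2 : Measure (Fin d → ℝ)).real Set.univ
          ≤ ε / 2 / ((C : ℝ) + 1) * (C + 1) := by gcongr; linarith
        _ = ε / 2 := by field_simp
        _ < ε := by linarith
    · apply integrable_of_cont isCompact_Icc hp2
      unfold bsum
      exact continuous_finsetSum _ fun j _ => (mw_continuous a b _ _).const_mul _
    · exact g.integrable _
  simpa using h2.add h1

lemma tendsto_aux {X Y Z : Type*} [TopologicalSpace X] [TopologicalSpace Y] [TopologicalSpace Z]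
    {c : ℕ → X → Z} {S : Set X} {K : Set Y} {x₀ : X} {y₀ : Y} {z : Z}
    (h : Tendsto (fun p : ℕ × X => c p.1 p.2) (atTop ×ˢ 𝓝[S] x₀) (𝓝 z)) :
    Tendsto (fun y : ℕ × (X × Y) => c y.1 y.2.1) (atTop ×ˢ 𝓝[S ×ˢ K] (x₀, y₀)) (𝓝 z) := by
  have h1 : Tendsto (fun y : ℕ × (X × Y) => (y.1, y.2.1)) (atTop ×ˢ 𝓝[S ×ˢ K] (x₀, y₀))
      (atTop ×ˢ 𝓝[S] x₀) := by
    rw [nhdsWithin_prod_eq]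
    exact tendsto_fst.prodMk (tendsto_fst.comp tendsto_snd)
  exact Tendsto.comp (g := fun p : ℕ × X => c p.1 p.2) h h1

set_option maxHeartbeats 400000 in
/-- For `F ∈ C^{1,m}(M_F(K))` (`K = [a,b]^d`): the functional derivative
`F'(μ; ·)` is `C^m` and its `x`-derivatives up to order `m` are jointly continuous in
`(μ,x)`.  Then for every multi-index `l` with `|l| ≤ m` and every `C > 0`,
`sup_{x ∈ K, μ ∈ N_C} |∂^l_x P_n'(F)(μ;x) − ∂^l_x F'(μ;x)| → 0` as `n → ∞`, where
`P_n'(F)(μ;x) = Σ_j F'(χ_n(μ); a^n_j) φ^n_j(x)`. -/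
theorem statement12 (d m : ℕ) (a b : ℝ) (hab : a < b)
    (F : FiniteMeasure (Fin d → ℝ) → ℝ) (F' : FiniteMeasure (Fin d → ℝ) → (Fin d → ℝ) → ℝ)
    (hdiff : ∀ μ : FiniteMeasure (Fin d → ℝ),
      (μ : Measure (Fin d → ℝ)) (Set.Icc (fun _ => a) (fun _ => b))ᶜ = 0 →
      ∀ x ∈ Set.Icc (fun _ => a) (fun _ => b),
        Filter.Tendsto (fun ε : ℝ => (F (μ + ε.toNNReal • diracFM x) - F μ) / ε)
          (nhdsWithin 0 (Set.Ioi 0)) (nhds (F' μ x)))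
    (hsm : ∀ μ : FiniteMeasure (Fin d → ℝ), ContDiff ℝ m (F' μ))
    (hcontd : ∀ l : Fin d → ℕ, (∑ i, l i) ≤ m →
      ContinuousOn
        (fun p : FiniteMeasure (Fin d → ℝ) × (Fin d → ℝ) => multiDeriv d l (F' p.1) p.2)
        ({μ : FiniteMeasure (Fin d → ℝ) |
            (μ : Measure (Fin d → ℝ)) (Set.Icc (fun _ => a) (fun _ => b))ᶜ = 0} ×ˢ
          Set.Icc (fun _ => a) (fun _ => b)))
    (l : Fin d → ℕ) (hl : (∑ i, l i) ≤ m) (C : ℝ≥0) (hC : 0 < C) :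
    TendstoUniformlyOn
      (fun (n : ℕ) (p : FiniteMeasure (Fin d → ℝ) × (Fin d → ℝ)) =>
        multiDeriv d l
          (fun y => ∑ j : Fin d → Fin (n + 1),
            F' (chiB a b d n p.1) (bnode a b d n j) * bpoly a b d n j y) p.2)
      (fun p => multiDeriv d l (F' p.1) p.2) Filter.atTop
      {p : FiniteMeasure (Fin d → ℝ) × (Fin d → ℝ) |
        (p.1 : Measure (Fin d → ℝ)) (Set.Icc (fun _ => a) (fun _ => b))ᶜ = 0 ∧
          p.1 Set.univ ≤ C ∧ p.2 ∈ Set.Icc (fun _ => a) (fun _ => b)} := by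

  set Lst : List (Fin d) := (List.finRange d).flatMap fun i => List.replicate (l i) i with hLst
  have hlen : Lst.length = ∑ i, l i := length_list l
  set K : Set (Fin d → ℝ) := Set.Icc (fun _ => a) (fun _ => b) with hK
  have hKc : IsCompact K := isCompact_Icc
  set S : Set (FiniteMeasure (Fin d → ℝ)) := {μ : FiniteMeasure (Fin d → ℝ) |
    (μ : Measure (Fin d → ℝ)) Kᶜ = 0 ∧ μ.mass ≤ C} with hS
  have hSc : IsCompact S := by
    have := isCompact_setOfPred_finiteMeasure_le_of_isCompact C hKc
    convert this using 1
    ext μ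
    simp only [hS, Set.mem_ofPred_eq]
    rw [FiniteMeasure.null_iff_toMeasure_null]
    tauto
  have hset : {p : FiniteMeasure (Fin d → ℝ) × (Fin d → ℝ) |
        (p.1 : Measure (Fin d → ℝ)) Kᶜ = 0 ∧ p.1 Set.univ ≤ C ∧ p.2 ∈ K} = S ×ˢ K := by
    ext p
    simp only [hS, Set.mem_ofPred_eq, Set.mem_prod, and_assoc]
    rfl
  rw [hset, ← tendstoLocallyUniformlyOn_iff_tendstoUniformlyOn_of_compact (hSc.prod hKc),
    tendstoLocallyUniformlyOn_iff_forall_tendsto]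
  have hG : ContinuousOn (fun p : FiniteMeasure (Fin d → ℝ) × (Fin d → ℝ) =>
      pderL Lst (F' p.1) p.2) ({μ : FiniteMeasure (Fin d → ℝ) |
            (μ : Measure (Fin d → ℝ)) Kᶜ = 0} ×ˢ K) := by
    have := hcontd l hl
    simpa only [multiDeriv_eq_pderL] using this
  simp only [multiDeriv_eq_pderL, bern_eq_bsum hab, ← hLst]
  have hsub : S ×ˢ K ⊆ {μ : FiniteMeasure (Fin d → ℝ) |
            (μ : Measure (Fin d → ℝ)) Kᶜ = 0} ×ˢ K := fun p hp => ⟨hp.1.1, hp.2⟩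
  obtain ⟨M, hM⟩ := (hSc.prod hKc).exists_bound_of_continuousOn (hG.mono hsub)
  rintro ⟨μ₀, x₀⟩ hp₀
  set A := pderL Lst (F' μ₀) x₀ with hA
  have hMA : |A| ≤ M := hM (μ₀, x₀) hp₀
  have hM0 : 0 ≤ M := (abs_nonneg A).trans hMA
  have hT1 : Tendsto (fun y : ℕ × (FiniteMeasure (Fin d → ℝ) × (Fin d → ℝ)) =>
      pderL Lst (F' y.2.1) y.2.2) (atTop ×ˢ 𝓝[S ×ˢ K] (μ₀, x₀)) (𝓝 A) :=
    ((hG.mono hsub) (μ₀, x₀) hp₀).tendsto.comp tendsto_snd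
  have hT2 : Tendsto (fun y : ℕ × (FiniteMeasure (Fin d → ℝ) × (Fin d → ℝ)) =>
      pderL Lst (bsum a b ((b - a) / y.1) y.1 (fun _ => y.1) (F' (chiB a b d y.1 y.2.1))) y.2.2)
      (atTop ×ˢ 𝓝[S ×ˢ K] (μ₀, x₀)) (𝓝 A) := by
    rw [Metric.tendsto_nhds]
    intro ε hε
    -- continuity of G at the base point
    have hc := hG (μ₀, x₀) (hsub hp₀)
    rw [ContinuousWithinAt, Metric.tendsto_nhds] at hc
    have hc := hc (ε / 4) (by linarith)
    rw [nhdsWithin_prod_eq, eventually_prod_iff] at hc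
    obtain ⟨pa, hpa, pb, hpb, hc⟩ := hc
    rw [eventually_nhdsWithin_iff] at hpa
    rw [eventually_nhdsWithin_iff, Metric.eventually_nhds_iff] at hpb
    obtain ⟨δ, hδ, hpb⟩ := hpb
    have hchi : Tendsto (fun y : ℕ × (FiniteMeasure (Fin d → ℝ) × (Fin d → ℝ)) =>
        chiB a b d y.1 y.2.1) (atTop ×ˢ 𝓝[S ×ˢ K] (μ₀, x₀)) (𝓝 μ₀) := by
      exact tendsto_aux (chi_tendsto hab d C μ₀)
    have hev1 := hchi.eventually hpa
    have hfst : Tendsto (fun y : ℕ × (FiniteMeasure (Fin d → ℝ) × (Fin d → ℝ)) => y.1)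
      (atTop ×ˢ 𝓝[S ×ˢ K] (μ₀, x₀)) atTop := tendsto_fst
    have hsnd : Tendsto (fun y : ℕ × (FiniteMeasure (Fin d → ℝ) × (Fin d → ℝ)) => y.2)
      (atTop ×ˢ 𝓝[S ×ˢ K] (μ₀, x₀)) (𝓝[S ×ˢ K] (μ₀, x₀)) := tendsto_snd
    have hev2 := hsnd.eventually (self_mem_nhdsWithin)
    have hx2 : Tendsto (fun y : ℕ × (FiniteMeasure (Fin d → ℝ) × (Fin d → ℝ)) => y.2.2)
      (atTop ×ˢ 𝓝[S ×ˢ K] (μ₀, x₀)) (𝓝 x₀) :=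
      (continuous_snd.tendsto (μ₀, x₀)).comp (hsnd.mono_right nhdsWithin_le_nhds)
    have hev3 := (Metric.tendsto_nhds.1 hx2) (δ / 2) (half_pos hδ)
    have hev4 := hfst.eventually (eventually_ge_atTop (Lst.length + 1))
    have hev5 := hfst.eventually ((err_tendsto a b (Lst.length : ℝ) (2 * M / (δ / 2) ^ 2)
      d).eventually_lt_const (show (0 : ℝ) < ε / 4 by linarith))
    have hr : Tendsto (fun n : ℕ => rfac (n : ℝ) n Lst * A) atTop (𝓝 A) := by
      simpa using (rfac_tendsto Lst).mul_const A
    have hev6 := hfst.eventually ((Metric.tendsto_nhds.1 hr) (ε / 4) (by linarith))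
    filter_upwards [hev1, hev2, hev3, hev4, hev5, hev6] with y h1 h2 h3 h4 h5 h6
    have hsupp := chi_supp hab d y.1 y.2.1
    have hmass : (chiB a b d y.1 y.2.1).mass ≤ C := by
      rw [chi_mass hab d y.1 h2.1.1]
      exact h2.1.2
    have hlm : ContDiff ℝ (Lst.length : ℕ) (F' (chiB a b d y.1 y.2.1)) :=
      (hsm _).of_le (by rw [hlen]; exact_mod_cast hl)
    have hkey := key_est hab Lst hlm (n := y.1) (by omega) (by omega) h2.2 (A := A)
      (ε := ε / 4) (M := 2 * M) (δ := δ / 2) (half_pos hδ) (by positivity) (by linarith)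
      (by
        intro ξ hξ
        have := hM (chiB a b d y.1 y.2.1, ξ) ⟨⟨hsupp, hmass⟩, hξ⟩
        rw [Real.norm_eq_abs] at this
        have h7 := abs_sub (pderL Lst (F' (chiB a b d y.1 y.2.1)) ξ) A
        linarith)
      (by
        intro ξ hξ hd
        have hd2 : dist ξ x₀ < δ := by
          have := dist_triangle ξ y.2.2 x₀
          linarith
        have := hc (h1 hsupp) (hpb hd2 hξ)
        rw [Real.dist_eq] at this
        exact this.le)
    rw [Real.dist_eq] at h6 ⊢
    have := abs_sub_le (pderL Lst (bsum a b ((b - a) / y.1) y.1 (fun _ => y.1)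
      (F' (chiB a b d y.1 y.2.1))) y.2.2) (rfac (y.1 : ℝ) y.1 Lst * A) A
    linarith
  exact (hT1.prodMk_nhds hT2).mono_right (nhds_le_uniformity A)
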